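/- arXiv:2201.02758 — 3 statements merged into one kernel-verified Lean document; each statement's English description precedes it below -/
import Mathlib

section
/- Let q be a prime power, k, t, h integers with k ≥ 3, t ≥ 1, h ≥ 0, t+h ≤ k−1, η ∈ 𝔽_q^*, and suppose (q−2t+1)/2 < k ≤ (q−t+1)/2. Let α = (α_1,…,α_q) list all elements of 𝔽_q and let C² denote the Schur square of the standard TRS code C_{V_{k,t,h,η}}. Then: (a) if h = 0, t = k−1 and q = 4k−4, then C² = span{ α^s (s ∈ S_{3k−3} \ {0,1,2k−1}), α + η·α^{2k−1}, 1 + η²·α }; (b) if h = 0, t = k−1 and q < 4k−4, then C² = span{ α^s (s ∈ S_{3k−3} \ {1,2k−1}), α + η·α^{2k−1} }; (c) if h = 0 and t ≤ k−2, or h ≥ 1 and t+h ≤ k−1, then C² = RS_{2k−1+t}. Moreover, dim C² = 3k−3 when (h,t) = (0,k−1), and dim C² = 2k−1+t otherwise. -/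
open Polynomial

noncomputable section

/-- The set of `(k,t,h,η)`-twisted polynomials
`V_{k,t,h,η} = { ∑_{i<k} a_i x^i + η a_h x^(k-1+t) }`. -/
def twistedPolySet (F : Type) [Field F] (k t h : ℕ) (η : F) : Set (Polynomial F) :=
  { f | ∃ a : ℕ → F,
      f = (∑ i ∈ Finset.range k, Polynomial.C (a i) * Polynomial.X ^ i)
          + Polynomial.C (η * a h) * Polynomial.X ^ (k - 1 + t) }

/-- The evaluation code `C_V(α, v) = { (v_j f(α_j))_j : f ∈ V }`. -/
def evalCode {F : Type} [Field F] {n : ℕ} (V : Set (Polynomial F)) (α v : Fin n → F) :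
    Set (Fin n → F) :=
  { c | ∃ f ∈ V, c = fun j => v j * f.eval (α j) }

/-- The standard code: evaluation (with coefficients 1) at all elements of `F`. -/
def stdCode (F : Type) [Field F] (V : Set (Polynomial F)) : Set (F → F) :=
  { c | ∃ f ∈ V, c = fun x => f.eval x }

/-- The Schur square `C² = span { c₁ * c₂ : c₁, c₂ ∈ C }` (coordinatewise product). -/
def schurSq {F : Type} [Field F] {ι : Type} (C : Set (ι → F)) : Submodule F (ι → F) :=
  Submodule.span F { x | ∃ c₁ ∈ C, ∃ c₂ ∈ C, x = c₁ * c₂ }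

/-- The (Euclidean) dual code. -/
def dualCode {F : Type} [Field F] {ι : Type} [Fintype ι] (C : Set (ι → F)) : Set (ι → F) :=
  { x | ∀ c ∈ C, ∑ j, x j * c j = 0 }

/-- A code is self-orthogonal if it is contained in its dual. -/
def SelfOrthogonal {F : Type} [Field F] {ι : Type} [Fintype ι] (C : Set (ι → F)) : Prop :=
  C ⊆ dualCode C

/-- The evaluation vector of the monomial `X ^ n` at all elements of `F`. -/
def monoVec (F : Type) [Field F] (n : ℕ) : F → F := fun x => x ^ n

/-- Generators of the standard twisted code. -/
def twistedGens (F : Type) [Field F] (k t h : ℕ) (η : F) : Set (F → F) :=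
  (monoVec F '' {i | i < k ∧ i ≠ h}) ∪ {monoVec F h + η • monoVec F (k - 1 + t)}

lemma monoVec_mul {F : Type} [Field F] (a b : ℕ) :
    monoVec F a * monoVec F b = monoVec F (a + b) := by
  ext x; simp [monoVec, pow_add]

lemma monoVec_add_card_sub_one {F : Type} [Field F] [Fintype F] {n : ℕ} (hn : 1 ≤ n) :
    monoVec F (n + (Fintype.card F - 1)) = monoVec F n := by
  ext x
  have hc : 1 ≤ Fintype.card F := Fintype.card_pos
  obtain ⟨m, rfl⟩ := Nat.exists_eq_add_of_le' hn
  simp only [monoVec]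
  rw [show m + 1 + (Fintype.card F - 1) = m + Fintype.card F by omega, pow_add, FiniteField.pow_card,
    pow_succ]

lemma linearIndepOn_monoVec (F : Type) [Field F] [Fintype F] :
    LinearIndepOn F (monoVec F) (Finset.range (Fintype.card F) : Set ℕ) := by
  rw [linearIndepOn_finset_iff]
  intro a ha i hi
  set p : F[X] := ∑ j ∈ Finset.range (Fintype.card F), C (a j) * X ^ j with hp
  have hp0 : p = 0 := by
    by_contra hne
    have hd : p.degree < (Fintype.card F : ℕ) := by
      rw [hp, ← mem_degreeLT]
      refine Submodule.sum_mem _ fun j hj => ?_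
      rw [mem_degreeLT]
      exact (degree_C_mul_X_pow_le _ _).trans_lt (by exact_mod_cast Finset.mem_range.1 hj)
    refine hne (eq_zero_of_degree_lt_of_eval_finset_eq_zero Finset.univ
      (by simpa using hd) fun x _ => ?_)
    have := congrFun ha x
    simpa [hp, eval_finsetSum, monoVec] using this
  have := congrArg (fun r => coeff r i) hp0
  have hi' := Finset.mem_range.1 hi
  simpa [hp, finsetSum_coeff, coeff_C_mul, coeff_X_pow, hi'] using this

lemma finrank_span_monoVec {F : Type} [Field F] [Fintype F] {n : ℕ} (hn : n ≤ Fintype.card F) :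
    Module.finrank F (Submodule.span F (monoVec F '' {i | i < n})) = n := by
  have h := (linearIndepOn_monoVec F).mono (t := {i | i < n}) (by
    intro i hi; simp only [Finset.coe_range, Set.mem_Iio]; exact lt_of_lt_of_le hi hn)
  rw [Set.image_eq_range, finrank_span_eq_card (b := fun i : {i | i < n} => monoVec F i) h]
  simp

lemma stdCode_degree_lt {F : Type} [Field F] (n : ℕ) :
    stdCode F {f : F[X] | f.degree < (n : ℕ)} = Submodule.span F (monoVec F '' {i | i < n}) := by
  ext c
  constructor
  · rintro ⟨f, hf, rfl⟩
    have h : (fun x => f.eval x) = ∑ i ∈ Finset.range n, f.coeff i • monoVec F i := by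
      ext x
      rcases eq_or_ne f 0 with rfl | hf0
      · simp
      · rw [eval_eq_sum_range' ((natDegree_lt_iff_degree_lt hf0).2 hf)]
        simp [monoVec]
    rw [h]
    exact Submodule.sum_mem _ fun i hi =>
      Submodule.smul_mem _ _ (Submodule.subset_span ⟨i, Finset.mem_range.1 hi, rfl⟩)
  · intro hc
    let Φ : F[X] →ₗ[F] (F → F) := LinearMap.pi fun x => leval x
    have hle : Submodule.span F (monoVec F '' {i | i < n}) ≤ (degreeLT F n).map Φ := by
      rw [Submodule.span_le]
      rintro _ ⟨i, hi, rfl⟩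
      refine ⟨X ^ i, mem_degreeLT.2 ?_, ?_⟩
      · rw [degree_X_pow]; exact_mod_cast hi
      · ext x; simp [Φ, monoVec]
    obtain ⟨f, hf, rfl⟩ := hle hc
    exact ⟨f, mem_degreeLT.1 hf, rfl⟩

lemma stdCode_twistedPolySet {F : Type} [Field F] {k t h : ℕ} (hh : h < k) (η : F) :
    stdCode F (twistedPolySet F k t h η) = Submodule.span F (twistedGens F k t h η) := by
  let Φ : (ℕ → F) →ₗ[F] (F → F) :=
    ∑ i ∈ Finset.range k, (LinearMap.proj i : (ℕ → F) →ₗ[F] F).smulRight (monoVec F i) +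
      (LinearMap.proj h : (ℕ → F) →ₗ[F] F).smulRight (η • monoVec F (k - 1 + t))
  have hΦ (a : ℕ → F) : Φ a =
      ∑ i ∈ Finset.range k, a i • monoVec F i + a h • η • monoVec F (k - 1 + t) := by
    simp [Φ, LinearMap.sum_apply]
  have hrange : stdCode F (twistedPolySet F k t h η) = LinearMap.range Φ := by
    have heval (a : ℕ → F) : (fun x => eval x ((∑ i ∈ Finset.range k, C (a i) * X ^ i)
        + C (η * a h) * X ^ (k - 1 + t))) = Φ a := by
      ext x
      simp only [hΦ, eval_add, eval_finsetSum, eval_mul, eval_C, eval_pow, eval_X, Pi.add_apply,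
        Finset.sum_apply, Pi.smul_apply, smul_eq_mul, monoVec]
      ring
    ext c
    constructor
    · rintro ⟨_, ⟨a, rfl⟩, rfl⟩
      exact ⟨a, (heval a).symm⟩
    · rintro ⟨a, rfl⟩
      exact ⟨_, ⟨a, rfl⟩, (heval a).symm⟩
  rw [hrange, SetLike.coe_set_eq]
  apply le_antisymm
  · rintro _ ⟨a, rfl⟩
    rw [hΦ, ← Finset.sum_erase_add _ _ (Finset.mem_range.2 hh), add_assoc, ← smul_add]
    refine add_mem (Submodule.sum_mem _ fun i hi => Submodule.smul_mem _ _ ?_)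
      (Submodule.smul_mem _ _ (Submodule.subset_span (Or.inr rfl)))
    rw [Finset.mem_erase, Finset.mem_range] at hi
    exact Submodule.subset_span (Or.inl ⟨i, ⟨hi.2, hi.1⟩, rfl⟩)
  · rw [Submodule.span_le]
    rintro _ (⟨i, ⟨hi, hih⟩, rfl⟩ | rfl)
    · refine ⟨Pi.single i 1, ?_⟩
      rw [hΦ, Finset.sum_eq_single_of_mem i (Finset.mem_range.2 hi)]
      · simp [hih.symm]
      · intro j _ hj; simp [hj]
    · refine ⟨Pi.single h 1, ?_⟩
      rw [hΦ, Finset.sum_eq_single_of_mem h (Finset.mem_range.2 hh)]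
      · simp
      · intro j _ hj; simp [hj]

open scoped Pointwise in
lemma schurSq_coe_span {F : Type} [Field F] {ι : Type} (S : Set (ι → F)) :
    schurSq (Submodule.span F S : Set (ι → F)) = Submodule.span F (S * S) := by
  rw [← Submodule.span_mul_span, Submodule.mul_eq_span_mul_set, schurSq]
  congr 1
  ext x
  simp [Set.mem_mul, eq_comm]

lemma monoVec_mem_iff_of_add_smul_mem {F : Type} [Field F] {N : Submodule F (F → F)} {η : F}
    (hη : η ≠ 0) {a b : ℕ} (hab : monoVec F a + η • monoVec F b ∈ N) :
    monoVec F a ∈ N ↔ monoVec F b ∈ N := by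
  rw [← N.smul_mem_iff hη (x := monoVec F b)]
  exact ⟨fun h => (N.add_mem_iff_right h).1 hab, fun h => (N.add_mem_iff_left h).1 hab⟩

section SchurSquare

open scoped Pointwise

variable {F : Type} [Field F] {k t h : ℕ} {η : F}

lemma monoVec_mem_schurSq (hh : h < k) {i j : ℕ} (hi : i < k) (hih : i ≠ h) (hj : j < k)
    (hjh : j ≠ h) : monoVec F (i + j) ∈ schurSq (stdCode F (twistedPolySet F k t h η)) := by
  rw [stdCode_twistedPolySet hh, schurSq_coe_span, ← monoVec_mul]
  exact Submodule.subset_span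
    (Set.mul_mem_mul (Or.inl ⟨i, ⟨hi, hih⟩, rfl⟩) (Or.inl ⟨j, ⟨hj, hjh⟩, rfl⟩))

lemma monoVec_mem_schurSq_of_eq_add (hh : h < k) {s : ℕ} (i j : ℕ) (hs : s = i + j) (hi : i < k)
    (hih : i ≠ h) (hj : j < k) (hjh : j ≠ h) :
    monoVec F s ∈ schurSq (stdCode F (twistedPolySet F k t h η)) :=
  hs ▸ monoVec_mem_schurSq hh hi hih hj hjh

lemma monoVec_mem_schurSq_zero (hk : 3 ≤ k) {s : ℕ} (hs : 2 ≤ s) (hs' : s ≤ 2 * k - 2) :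
    monoVec F s ∈ schurSq (stdCode F (twistedPolySet F k t 0 η)) := by
  rcases Nat.lt_or_ge s k with hsk | hsk
  · exact monoVec_mem_schurSq_of_eq_add (by omega) 1 (s - 1) (by omega) (by omega) (by omega)
      (by omega) (by omega)
  · exact monoVec_mem_schurSq_of_eq_add (by omega) (k - 1) (s - (k - 1)) (by omega) (by omega)
      (by omega) (by omega) (by omega)

lemma twisted_mul_monoVec_mem_schurSq (hh : h < k) {i : ℕ} (hi : i < k) (hih : i ≠ h) :
    monoVec F (h + i) + η • monoVec F (k - 1 + t + i) ∈
      schurSq (stdCode F (twistedPolySet F k t h η)) := by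
  rw [stdCode_twistedPolySet hh, schurSq_coe_span, ← monoVec_mul, ← monoVec_mul, ← smul_mul_assoc,
    ← add_mul]
  exact Submodule.subset_span (Set.mul_mem_mul (Or.inr rfl) (Or.inl ⟨i, ⟨hi, hih⟩, rfl⟩))

lemma monoVec_mem_schurSq_extremal (hη : η ≠ 0) (hk : 3 ≤ k) {s : ℕ} (hs : s ≤ 3 * k - 3)
    (hs2 : 2 ≤ s) (hsk : s ≠ 2 * k - 1) :
    monoVec F s ∈ schurSq (stdCode F (twistedPolySet F k (k - 1) 0 η)) := by
  rcases Nat.lt_or_ge (2 * k - 2) s with h | h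
  · have hm := twisted_mul_monoVec_mem_schurSq (F := F) (t := k - 1) (η := η) (h := 0)
      (show 0 < k by omega) (show s - (2 * k - 2) < k by omega) (by omega)
    rw [show k - 1 + (k - 1) + (s - (2 * k - 2)) = s by omega, zero_add] at hm
    exact (monoVec_mem_iff_of_add_smul_mem hη hm).1
      (monoVec_mem_schurSq_zero hk (by omega) (by omega))
  · exact monoVec_mem_schurSq_zero hk hs2 h

lemma one_twist_mem_schurSq_extremal (hk : 3 ≤ k) :
    monoVec F 1 + η • monoVec F (2 * k - 1) ∈
      schurSq (stdCode F (twistedPolySet F k (k - 1) 0 η)) := by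
  have hm := twisted_mul_monoVec_mem_schurSq (F := F) (t := k - 1) (η := η) (h := 0)
    (show 0 < k by omega) (show 1 < k by omega) one_ne_zero
  rwa [show k - 1 + (k - 1) + 1 = 2 * k - 1 by omega, zero_add] at hm

variable [Fintype F]

lemma twisted_mul_twisted {e : ℕ} (he : 1 ≤ e)
    (hcard : e + (Fintype.card F - 1) = 2 * (k - 1 + t)) :
    (monoVec F h + η • monoVec F (k - 1 + t)) * (monoVec F h + η • monoVec F (k - 1 + t)) =
      monoVec F (2 * h) + (2 * η) • monoVec F (k - 1 + t + h) + η ^ 2 • monoVec F e := by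
  rw [← monoVec_add_card_sub_one he, hcard]
  ext x
  simp only [monoVec, Pi.mul_apply, Pi.add_apply, Pi.smul_apply, smul_eq_mul]
  ring

lemma schurSq_twisted_le (hh : h < k) {e : ℕ} (he : 1 ≤ e)
    (hcard : e + (Fintype.card F - 1) = 2 * (k - 1 + t)) {N : Submodule F (F → F)}
    (hmm : ∀ i j, i < k → i ≠ h → j < k → j ≠ h → monoVec F (i + j) ∈ N)
    (hmt : ∀ i, i < k → i ≠ h → monoVec F (h + i) + η • monoVec F (k - 1 + t + i) ∈ N)
    (htt : monoVec F (2 * h) + (2 * η) • monoVec F (k - 1 + t + h) + η ^ 2 • monoVec F e ∈ N) :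
    schurSq (stdCode F (twistedPolySet F k t h η)) ≤ N := by
  rw [stdCode_twistedPolySet hh, schurSq_coe_span, Submodule.span_le]
  rintro _ ⟨_, ⟨i, ⟨hi, hih⟩, rfl⟩ | rfl, _, ⟨j, ⟨hj, hjh⟩, rfl⟩ | rfl, rfl⟩
  · simpa only [monoVec_mul, SetLike.mem_coe] using hmm i j hi hih hj hjh
  · simpa only [mul_add, mul_smul_comm, monoVec_mul, add_comm i, SetLike.mem_coe] using hmt i hi hih
  · simpa only [add_mul, smul_mul_assoc, monoVec_mul, SetLike.mem_coe] using hmt j hj hjh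
  · simpa only [twisted_mul_twisted he hcard, SetLike.mem_coe] using htt

lemma twisted_sq_mem_schurSq (hh : h < k) {e : ℕ} (he : 1 ≤ e)
    (hcard : e + (Fintype.card F - 1) = 2 * (k - 1 + t)) :
    monoVec F (2 * h) + (2 * η) • monoVec F (k - 1 + t + h) + η ^ 2 • monoVec F e ∈
      schurSq (stdCode F (twistedPolySet F k t h η)) := by
  rw [stdCode_twistedPolySet hh, schurSq_coe_span, ← twisted_mul_twisted he hcard]
  exact Submodule.subset_span (Set.mul_mem_mul (Or.inr rfl) (Or.inr rfl))

lemma card_ne_six (F : Type) [Field F] [Fintype F] : Fintype.card F ≠ 6 := by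
  intro h6
  obtain ⟨p, _, n, hp, hc⟩ := FiniteField.card' F
  rw [h6] at hc
  have h2 : 2 = p := (Nat.prime_dvd_prime_iff_eq Nat.prime_two hp).1
    (Nat.prime_two.dvd_of_dvd_pow (n := n) (hc ▸ by norm_num))
  have h3 : 3 = p := (Nat.prime_dvd_prime_iff_eq Nat.prime_three hp).1
    (Nat.prime_three.dvd_of_dvd_pow (n := n) (hc ▸ by norm_num))
  omega

lemma monoVec_mem_schurSq_low (hη : η ≠ 0) (hk : 3 ≤ k) (ht : 1 ≤ t) (hth : t + h ≤ k - 1)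
    (h1 : Fintype.card F + 1 < 2 * k + 2 * t) (h2 : 2 * k + t ≤ Fintype.card F + 1)
    (hne : ¬(h = 0 ∧ t = k - 1)) {s : ℕ} (hs : s ≤ 2 * k - 2) :
    monoVec F s ∈ schurSq (stdCode F (twistedPolySet F k t h η)) := by
  have hh : h < k := by omega
  rcases Nat.eq_zero_or_pos h with rfl | hpos
  · have hone : monoVec F 1 ∈ schurSq (stdCode F (twistedPolySet F k t 0 η)) := by
      have hm := twisted_mul_monoVec_mem_schurSq (F := F) (t := t) (η := η) hh
        (show 1 < k by omega) one_ne_zero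
      rw [zero_add] at hm
      rw [monoVec_mem_iff_of_add_smul_mem hη hm]
      exact monoVec_mem_schurSq_zero hk (by omega) (by omega)
    have hpos : ∀ r, 1 ≤ r → r ≤ 2 * k - 2 →
        monoVec F r ∈ schurSq (stdCode F (twistedPolySet F k t 0 η)) := fun r hr hr' => by
      rcases hr.eq_or_lt with rfl | hr
      · exact hone
      · exact monoVec_mem_schurSq_zero hk hr hr'
    rcases Nat.eq_zero_or_pos s with rfl | hs0
    · have hm := twisted_sq_mem_schurSq (F := F) (η := η) hh
        (e := 2 * k + 2 * t - Fintype.card F - 1) (by omega) (t := t) (by omega)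
      rw [Submodule.add_mem_iff_left _ (Submodule.smul_mem _ _ (hpos _ (by omega) (by omega))),
        Submodule.add_mem_iff_left _ (Submodule.smul_mem _ _ (hpos _ (by omega) (by omega)))] at hm
      exact hm
    · exact hpos s hs0 hs
  · have hk4 : k ≠ 3 := by
      have := card_ne_six F
      omega
    have hgen : ∀ r, r ≤ 2 * k - 2 → ¬(h = 1 ∧ r = 1) → ¬(h = k - 2 ∧ r = 2 * k - 3) →
        monoVec F r ∈ schurSq (stdCode F (twistedPolySet F k t h η)) := fun r hr hr1 hr2 => by
      rcases Nat.lt_or_ge r k with hrk | hrk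
      · by_cases hrh : r = h
        · exact monoVec_mem_schurSq_of_eq_add hh 1 (r - 1) (by omega) (by omega) (by omega)
            (by omega) (by omega)
        · exact monoVec_mem_schurSq_of_eq_add hh 0 r (by omega) (by omega) (by omega)
            (by omega) (by omega)
      · by_cases hrh : r = k - 1 + h
        · exact monoVec_mem_schurSq_of_eq_add hh (k - 2) (h + 1) (by omega) (by omega) (by omega)
            (by omega) (by omega)
        · exact monoVec_mem_schurSq_of_eq_add hh (k - 1) (r - (k - 1)) (by omega) (by omega)
            (by omega) (by omega) (by omega)
    by_cases hs1 : h = 1 ∧ s = 1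
    · obtain ⟨rfl, rfl⟩ := hs1
      have hm := twisted_mul_monoVec_mem_schurSq (F := F) (t := t) (η := η) hh
        (show 0 < k by omega) zero_ne_one
      rw [add_zero, add_zero] at hm
      rw [monoVec_mem_iff_of_add_smul_mem hη hm]
      exact hgen _ (by omega) (by omega) (by omega)
    by_cases hs2 : h = k - 2 ∧ s = 2 * k - 3
    · have hm := twisted_mul_monoVec_mem_schurSq (F := F) (t := t) (η := η) hh
        (show k - 3 < k by omega) (by omega)
      rw [show k - 1 + t + (k - 3) = s by omega] at hm
      rw [← monoVec_mem_iff_of_add_smul_mem hη hm]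
      exact hgen _ (by omega) (by omega) (by omega)
    exact hgen s hs hs1 hs2

lemma schurSq_twisted_eq_span (hη : η ≠ 0) (hk : 3 ≤ k) (ht : 1 ≤ t) (hth : t + h ≤ k - 1)
    (h1 : Fintype.card F + 1 < 2 * k + 2 * t) (h2 : 2 * k + t ≤ Fintype.card F + 1)
    (hne : ¬(h = 0 ∧ t = k - 1)) :
    schurSq (stdCode F (twistedPolySet F k t h η)) =
      Submodule.span F (monoVec F '' {i | i < 2 * k - 1 + t}) := by
  have hh : h < k := by omega
  have hN : ∀ r, r < 2 * k - 1 + t →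
      monoVec F r ∈ Submodule.span F (monoVec F '' {i | i < 2 * k - 1 + t}) :=
    fun r hr => Submodule.subset_span ⟨r, hr, rfl⟩
  apply le_antisymm
  · refine schurSq_twisted_le hh (e := 2 * k + 2 * t - Fintype.card F - 1) (by omega) (by omega)
      (fun i j _ _ _ _ => hN _ (by omega))
      (fun i _ _ => add_mem (hN _ (by omega)) (Submodule.smul_mem _ _ (hN _ (by omega))))
      (add_mem (add_mem (hN _ (by omega)) (Submodule.smul_mem _ _ (hN _ (by omega))))
        (Submodule.smul_mem _ _ (hN _ (by omega))))
  · rw [Submodule.span_le]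
    rintro _ ⟨s, hs, rfl⟩
    rw [Set.mem_ofPred_eq] at hs
    rcases Nat.lt_or_ge (2 * k - 2) s with hsk | hsk
    · have hm := twisted_mul_monoVec_mem_schurSq (F := F) (t := t) (η := η) hh
        (show s - (k - 1 + t) < k by omega) (by omega)
      rw [show k - 1 + t + (s - (k - 1 + t)) = s by omega] at hm
      exact (monoVec_mem_iff_of_add_smul_mem hη hm).1
        (monoVec_mem_schurSq_low hη hk ht hth h1 h2 hne (by omega))
    · exact monoVec_mem_schurSq_low hη hk ht hth h1 h2 hne hsk

lemma one_add_smul_mem_schurSq_extremal (hk : 3 ≤ k) {e : ℕ} (he : 1 ≤ e)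
    (hcard : e + (Fintype.card F - 1) = 2 * (k - 1 + (k - 1))) :
    monoVec F 0 + η ^ 2 • monoVec F e ∈
      schurSq (stdCode F (twistedPolySet F k (k - 1) 0 η)) := by
  have hm := twisted_sq_mem_schurSq (F := F) (η := η) (h := 0) (show 0 < k by omega) he hcard
  rw [add_right_comm] at hm
  exact (Submodule.add_mem_iff_left _ (Submodule.smul_mem _ _
    (monoVec_mem_schurSq_zero hk (by omega) (by omega)))).1 hm

lemma schurSq_extremal_le (hk : 3 ≤ k) {e : ℕ} (he : 1 ≤ e)
    (hcard : e + (Fintype.card F - 1) = 2 * (k - 1 + (k - 1))) {N : Submodule F (F → F)}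
    (hmono : ∀ s, 2 ≤ s → s ≤ 3 * k - 3 → s ≠ 2 * k - 1 → monoVec F s ∈ N)
    (hone : monoVec F 1 + η • monoVec F (2 * k - 1) ∈ N)
    (hzero : monoVec F 0 + η ^ 2 • monoVec F e ∈ N) :
    schurSq (stdCode F (twistedPolySet F k (k - 1) 0 η)) ≤ N := by
  refine schurSq_twisted_le (by omega) he hcard
    (fun i j _ _ _ _ => hmono _ (by omega) (by omega) (by omega)) (fun i hi hi0 => ?_) ?_
  · by_cases hi1 : i = 1
    · subst hi1
      rwa [show k - 1 + (k - 1) + 1 = 2 * k - 1 by omega, zero_add]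
    · exact add_mem (hmono _ (by omega) (by omega) (by omega))
        (Submodule.smul_mem _ _ (hmono _ (by omega) (by omega) (by omega)))
  · rw [add_right_comm]
    exact add_mem hzero (Submodule.smul_mem _ _ (hmono _ (by omega) (by omega) (by omega)))

lemma finrank_schurSq_extremal (hη : η ≠ 0) (hk : 3 ≤ k)
    (h1 : Fintype.card F + 1 < 2 * k + 2 * (k - 1)) (h2 : 2 * k + (k - 1) ≤ Fintype.card F + 1) :
    Module.finrank F (schurSq (stdCode F (twistedPolySet F k (k - 1) 0 η))) = 3 * k - 3 := by
  classical
  obtain ⟨e, he, hcard⟩ : ∃ e, 1 ≤ e ∧ e + (Fintype.card F - 1) = 2 * (k - 1 + (k - 1)) :=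
    ⟨4 * k - 3 - Fintype.card F, by omega, by omega⟩
  set T := schurSq (stdCode F (twistedPolySet F k (k - 1) 0 η)) with hT
  apply le_antisymm
  · let f : ℕ → F → F := fun s =>
      if s = 0 then monoVec F 0 + η ^ 2 • monoVec F e
      else if s = 1 then monoVec F 1 + η • monoVec F (2 * k - 1) else monoVec F s
    let S : Finset ℕ := (Finset.range (3 * k - 2)).erase (2 * k - 1)
    have hmem (s : ℕ) (hs : s < 3 * k - 2) (hsk : s ≠ 2 * k - 1) :
        f s ∈ Submodule.span F (S.image f : Set (F → F)) :=
      Submodule.subset_span (Finset.mem_coe.2 (Finset.mem_image_of_mem f (by simp [S, hs, hsk])))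
    have hle : T ≤ Submodule.span F (S.image f : Set (F → F)) :=
      schurSq_extremal_le hk he hcard
        (fun s hs hs' hsk => by
          simpa [f, show s ≠ 0 by omega, show s ≠ 1 by omega] using hmem s (by omega) hsk)
        (by simpa [f] using hmem 1 (by omega) (by omega))
        (by simpa [f] using hmem 0 (by omega) (by omega))
    calc Module.finrank F T ≤ _ := Submodule.finrank_mono hle
      _ ≤ (S.image f).card := finrank_span_finset_le_card _
      _ ≤ S.card := Finset.card_image_le
      _ = 3 * k - 3 := by
        rw [Finset.card_erase_of_mem (Finset.mem_range.2 (by omega)), Finset.card_range]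
        omega
  · have hone : monoVec F 1 ∈ T ⊔ Submodule.span F {monoVec F 1} :=
      Submodule.mem_sup_right (Submodule.mem_span_singleton_self _)
    have hpos (s : ℕ) (hs : s ≤ 3 * k - 3) (hs0 : 1 ≤ s) :
        monoVec F s ∈ T ⊔ Submodule.span F {monoVec F 1} := by
      by_cases hs1 : s = 1
      · exact hs1 ▸ hone
      by_cases hsk : s = 2 * k - 1
      · rw [hsk]
        exact (monoVec_mem_iff_of_add_smul_mem hη
          (Submodule.mem_sup_left (one_twist_mem_schurSq_extremal hk))).1 hone
      exact Submodule.mem_sup_left (monoVec_mem_schurSq_extremal hη hk hs (by omega) hsk)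
    have hle : Submodule.span F (monoVec F '' {i | i < 3 * k - 2}) ≤
        T ⊔ Submodule.span F {monoVec F 1} := by
      rw [Submodule.span_le]
      rintro _ ⟨s, hs, rfl⟩
      rw [Set.mem_ofPred_eq] at hs
      rcases Nat.eq_zero_or_pos s with rfl | hs0
      · exact (monoVec_mem_iff_of_add_smul_mem (pow_ne_zero 2 hη) (Submodule.mem_sup_left
          (one_add_smul_mem_schurSq_extremal hk he hcard))).2 (hpos e (by omega) he)
      · exact hpos s (by omega) hs0
    have hd := Submodule.finrank_mono hle
    rw [finrank_span_monoVec (by omega)] at hd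
    have hadd := Submodule.finrank_add_le_finrank_add_finrank T (Submodule.span F {monoVec F 1})
    have hsing : Module.finrank F (Submodule.span F {monoVec F 1}) ≤ 1 := by
      simpa using finrank_span_le_card (R := F) ({monoVec F 1} : Set (F → F))
    omega

end SchurSquare

theorem stmt_5 (F : Type) [Field F] [Fintype F] (q k t h : ℕ)
    (hq : Fintype.card F = q) (hk : 3 ≤ k) (ht : 1 ≤ t)
    (hth : t + h ≤ k - 1)
    (η : F) (hη : η ≠ 0)
    (h1 : q + 1 < 2 * k + 2 * t) (h2 : 2 * k + t ≤ q + 1) :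
    (h = 0 → t = k - 1 → q = 4 * k - 4 →
      schurSq (stdCode F (twistedPolySet F k t h η)) =
        Submodule.span F
          (((fun s : ℕ => fun x : F => x ^ s) ''
              {s : ℕ | s ≤ 3 * k - 3 ∧ s ≠ 0 ∧ s ≠ 1 ∧ s ≠ 2 * k - 1}) ∪
            {fun x : F => x + η * x ^ (2 * k - 1), fun x : F => 1 + η ^ 2 * x})) ∧
    (h = 0 → t = k - 1 → q < 4 * k - 4 →
      schurSq (stdCode F (twistedPolySet F k t h η)) =
        Submodule.span F
          (((fun s : ℕ => fun x : F => x ^ s) ''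
              {s : ℕ | s ≤ 3 * k - 3 ∧ s ≠ 1 ∧ s ≠ 2 * k - 1}) ∪
            {fun x : F => x + η * x ^ (2 * k - 1)})) ∧
    ((h = 0 ∧ t ≤ k - 2) ∨ (1 ≤ h ∧ t + h ≤ k - 1) →
      (schurSq (stdCode F (twistedPolySet F k t h η)) : Set (F → F)) =
        stdCode F {f : Polynomial F | f.degree < (2 * k - 1 + t : ℕ)}) ∧
    (h = 0 ∧ t = k - 1 →
      Module.finrank F (schurSq (stdCode F (twistedPolySet F k t h η))) = 3 * k - 3) ∧
    (¬(h = 0 ∧ t = k - 1) →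
      Module.finrank F (schurSq (stdCode F (twistedPolySet F k t h η))) = 2 * k - 1 + t) := by
  subst hq
  refine ⟨?_, ?_, fun _ => ?_, ?_, fun hne => ?_⟩
  · rintro rfl rfl hq
    have hcard : 1 + (Fintype.card F - 1) = 2 * (k - 1 + (k - 1)) := by omega
    apply le_antisymm
    · exact schurSq_extremal_le hk le_rfl hcard
        (fun s hs hs' hsk =>
          Submodule.subset_span (Or.inl ⟨s, ⟨hs', by omega, by omega, hsk⟩, rfl⟩))
        (Submodule.subset_span (Or.inr (Or.inl (by ext; simp [monoVec]))))
        (Submodule.subset_span (Or.inr (Or.inr (by ext; simp [monoVec]))))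
    · rw [Submodule.span_le]
      rintro _ (⟨s, ⟨hs, hs0, hs1, hsk⟩, rfl⟩ | rfl | rfl)
      · exact monoVec_mem_schurSq_extremal hη hk hs (by omega) hsk
      · exact Set.mem_of_eq_of_mem (by ext; simp [monoVec])
          (one_twist_mem_schurSq_extremal (F := F) (η := η) hk)
      · exact Set.mem_of_eq_of_mem (by ext; simp [monoVec])
          (one_add_smul_mem_schurSq_extremal (F := F) (η := η) hk le_rfl hcard)
  · rintro rfl rfl hq
    obtain ⟨e, he, hcard⟩ : ∃ e, 2 ≤ e ∧ e + (Fintype.card F - 1) = 2 * (k - 1 + (k - 1)) :=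
      ⟨4 * k - 3 - Fintype.card F, by omega, by omega⟩
    apply le_antisymm
    · have hmono (s : ℕ) (hs : s ≤ 3 * k - 3 ∧ s ≠ 1 ∧ s ≠ 2 * k - 1) :
          monoVec F s ∈ Submodule.span F
            (((fun s : ℕ => fun x : F => x ^ s) '' {s : ℕ | s ≤ 3 * k - 3 ∧ s ≠ 1 ∧ s ≠ 2 * k - 1}) ∪
              {fun x : F => x + η * x ^ (2 * k - 1)}) :=
        Submodule.subset_span (Or.inl ⟨s, hs, rfl⟩)
      exact schurSq_extremal_le hk (by omega) hcard
        (fun s hs hs' hsk => hmono s ⟨hs', by omega, hsk⟩)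
        (Submodule.subset_span (Or.inr (by ext; simp [monoVec])))
        (add_mem (hmono 0 (by omega)) (Submodule.smul_mem _ _ (hmono e (by omega))))
    · rw [Submodule.span_le]
      rintro _ (⟨s, ⟨hs, hs1, hsk⟩, rfl⟩ | rfl)
      · rcases Nat.eq_zero_or_pos s with rfl | hs0
        · exact (monoVec_mem_iff_of_add_smul_mem (pow_ne_zero 2 hη)
            (one_add_smul_mem_schurSq_extremal hk (by omega) hcard)).2
            (monoVec_mem_schurSq_extremal hη hk (by omega) he (by omega))
        · exact monoVec_mem_schurSq_extremal hη hk hs (by omega) hsk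
      · exact Set.mem_of_eq_of_mem (by ext; simp [monoVec])
          (one_twist_mem_schurSq_extremal (F := F) (η := η) hk)
  · rw [stdCode_degree_lt, schurSq_twisted_eq_span hη hk ht hth h1 h2 (by omega)]
  · rintro ⟨rfl, rfl⟩
    exact finrank_schurSq_extremal hη hk h1 h2
  · rw [schurSq_twisted_eq_span hη hk ht hth h1 h2 hne, finrank_span_monoVec (by omega)]
end
end

section
/- Let q be a prime power, k, t, h integers with k ≥ 3, t ≥ 1, h ≥ 0, η ∈ 𝔽_q^*, and suppose (q−2t+1)/2 < k ≤ (q−t+1)/2. If either h = 0 and t ≤ k−2, or h ≥ 1 and t+h ≤ k−1, then the dual code of the Schur square of the standard TRS code C_{V_{k,t,h,η}} equals the Reed–Solomon code RS_{q−2k−t+1}. -/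
open Polynomial

noncomputable section

section FiniteField

variable {F : Type} [Field F]

/-- The power function `x ↦ x ^ n`, as a word indexed by all elements of `F`. -/
def powWord (F : Type) [Field F] (n : ℕ) : F → F := fun x => x ^ n

theorem powWord_mul (m n : ℕ) : powWord F m * powWord F n = powWord F (m + n) := by
  funext x
  simp [powWord, pow_add]

theorem sum_eval_eq_neg_coeff [Fintype F] (g : F[X]) (hg : g.natDegree < Fintype.card F) :
    ∑ x : F, g.eval x = - g.coeff (Fintype.card F - 1) := by
  classical
  have hcard : 1 < Fintype.card F := Fintype.one_lt_card
  simp_rw [eval_eq_sum_range' hg]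
  rw [Finset.sum_comm]
  simp_rw [← Finset.mul_sum]
  rw [Finset.sum_eq_single (Fintype.card F - 1)]
  · have hsum : ∑ x : F, x ^ (Fintype.card F - 1) = -1 := by
      have hpow : ∀ x : F, x ^ (Fintype.card F - 1) = 1 - if x = 0 then 1 else 0 := by
        intro x
        split_ifs with hx
        · subst hx
          rw [zero_pow (by omega), sub_self]
        · rw [FiniteField.pow_card_sub_one_eq_one x hx, sub_zero]
      simp [hpow]
    rw [hsum, mul_neg_one]
  · intro i hi hne
    rw [Finset.mem_range] at hi
    rw [FiniteField.sum_pow_lt_card_sub_one F i (by omega), mul_zero]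
  · intro hmem
    exact absurd (Finset.mem_range.2 (by omega)) hmem

theorem powWord_add_card [Fintype F] (n : ℕ) :
    powWord F (n + Fintype.card F) = powWord F (n + 1) := by
  funext x
  simp [powWord, pow_add, FiniteField.pow_card]

theorem dualCode_span [Fintype F] (S : Set (F → F)) :
    dualCode (Submodule.span F S : Set (F → F)) = dualCode S := by
  ext w
  constructor
  · exact fun hw c hc => hw c (Submodule.subset_span hc)
  · intro hw c hc
    induction hc using Submodule.span_induction with
    | mem c hc => exact hw c hc
    | zero => simp
    | add c d _ _ hc hd => simp [mul_add, Finset.sum_add_distrib, hc, hd]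
    | smul a c _ hc =>
      simp_rw [Pi.smul_apply, smul_eq_mul, mul_left_comm _ a]
      rw [← Finset.mul_sum, hc, mul_zero]

/-- The dual of the full-length Reed–Solomon code of dimension `N` is the one of dimension
`q - N`. -/
theorem dualCode_span_powWord [Fintype F] (N : ℕ) (hN : N ≤ Fintype.card F) :
    dualCode (Submodule.span F (powWord F '' Set.Iio N) : Set (F → F)) =
      stdCode F {f : F[X] | f.degree < (Fintype.card F - N : ℕ)} := by
  classical
  rw [dualCode_span]
  have hcard : 0 < Fintype.card F := Fintype.card_pos
  have key (f : F[X]) (n : ℕ) (hf : f.natDegree + n < Fintype.card F) :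
      ∑ x : F, f.eval x * powWord F n x = -(f * X ^ n).coeff (Fintype.card F - 1) := by
    rw [← sum_eval_eq_neg_coeff]
    · simp [powWord]
    · exact (natDegree_mul_le.trans (by rw [natDegree_X_pow])).trans_lt hf
  ext w
  constructor
  · intro hw
    let f := Lagrange.interpolate Finset.univ id w
    have hinj : Set.InjOn (id : F → F) (Finset.univ : Finset F) := Set.injOn_id _
    have heval (x : F) : f.eval x = w x :=
      Lagrange.eval_interpolate_at_node w hinj (Finset.mem_univ x)
    have hdeg : f.degree < Fintype.card F := Lagrange.degree_interpolate_lt w hinj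
    refine ⟨f, ?_, funext fun x => (heval x).symm⟩
    by_contra hlt
    rw [Set.mem_ofPred_eq, not_lt] at hlt
    have hf : f ≠ 0 := by
      rintro h0
      rw [h0, degree_zero, le_bot_iff] at hlt
      exact WithBot.coe_ne_bot hlt
    rw [degree_eq_natDegree hf, Nat.cast_le] at hlt
    rw [degree_eq_natDegree hf, Nat.cast_lt] at hdeg
    have hn := hw (powWord F (Fintype.card F - 1 - f.natDegree))
      ⟨_, Set.mem_Iio.2 (by omega), rfl⟩
    simp_rw [← heval] at hn
    rw [key _ _ (by omega), coeff_mul_X_pow', if_pos (by omega),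
      show Fintype.card F - 1 - (Fintype.card F - 1 - f.natDegree) = f.natDegree by omega,
      neg_eq_zero, coeff_natDegree, leadingCoeff_eq_zero] at hn
    exact hf hn
  · rintro ⟨f, hf, rfl⟩ _ ⟨n, hn, rfl⟩
    rw [Set.mem_Iio] at hn
    rw [Set.mem_ofPred_eq] at hf
    by_cases h0 : f = 0
    · simp [h0]
    rw [degree_eq_natDegree h0, Nat.cast_lt] at hf
    rw [key _ _ (by omega), neg_eq_zero, coeff_mul_X_pow', if_pos (by omega)]
    exact coeff_eq_zero_of_natDegree_lt (by omega)

variable {k t h : ℕ} {η : F}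

theorem powWord_mem_stdCode {i : ℕ} (hi : i < k) (hih : i ≠ h) :
    powWord F i ∈ stdCode F (twistedPolySet F k t h η) := by
  refine ⟨_, ⟨Pi.single i 1, rfl⟩, ?_⟩
  funext x
  simp [powWord, Pi.single_apply, hih.symm, hi]

theorem twisted_powWord_mem_stdCode (hh : h < k) :
    powWord F h + η • powWord F (k - 1 + t) ∈ stdCode F (twistedPolySet F k t h η) := by
  refine ⟨_, ⟨Pi.single h 1, rfl⟩, ?_⟩
  funext x
  simp [powWord, Pi.single_apply, hh]

theorem mul_mem_schurSq {ι : Type} {C : Set (ι → F)} {c d : ι → F} (hc : c ∈ C) (hd : d ∈ C) :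
    c * d ∈ schurSq C :=
  Submodule.subset_span ⟨c, hc, d, hd, rfl⟩

theorem stdCode_twistedPolySet_subset :
    stdCode F (twistedPolySet F k t h η) ⊆
      Submodule.span F (powWord F '' {n | n < k ∨ n = k - 1 + t}) := by
  rintro _ ⟨_, ⟨a, rfl⟩, rfl⟩
  have hfun : (fun x => eval x ((∑ i ∈ Finset.range k, C (a i) * X ^ i)
      + C (η * a h) * X ^ (k - 1 + t))) =
      ∑ i ∈ Finset.range k, a i • powWord F i + (η * a h) • powWord F (k - 1 + t) := by
    funext x
    simp [powWord, eval_finsetSum]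
  rw [hfun]
  refine add_mem (sum_mem fun i hi => ?_) ?_
  · exact Submodule.smul_mem _ _
      (Submodule.subset_span ⟨i, Or.inl (Finset.mem_range.1 hi), rfl⟩)
  · exact Submodule.smul_mem _ _ (Submodule.subset_span ⟨_, Or.inr rfl, rfl⟩)

theorem schurSq_twisted_le_s8 [Fintype F] (hk : 1 ≤ k)
    (h1 : Fintype.card F + 1 < 2 * k + 2 * t) (h2 : 2 * k + t ≤ Fintype.card F + 1) :
    schurSq (stdCode F (twistedPolySet F k t h η)) ≤
      Submodule.span F (powWord F '' Set.Iio (2 * k + t - 1)) := by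
  have hprod : schurSq (stdCode F (twistedPolySet F k t h η)) ≤
      Submodule.span F (powWord F '' {n | n < k ∨ n = k - 1 + t}) *
        Submodule.span F (powWord F '' {n | n < k ∨ n = k - 1 + t}) := by
    refine Submodule.span_le.2 ?_
    rintro _ ⟨c, hc, d, hd, rfl⟩
    exact Submodule.mul_mem_mul (stdCode_twistedPolySet_subset hc)
      (stdCode_twistedPolySet_subset hd)
  refine hprod.trans ?_
  rw [Submodule.span_mul_span, Submodule.span_le]
  rintro _ ⟨_, ⟨m, hm, rfl⟩, _, ⟨n, hn, rfl⟩, rfl⟩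
  rw [Set.mem_ofPred_eq] at hm hn
  refine Submodule.subset_span ?_
  simp only [powWord_mul]
  by_cases hlt : m + n < 2 * k + t - 1
  · exact ⟨_, hlt, rfl⟩
  · refine ⟨m + n - Fintype.card F + 1, Set.mem_Iio.2 (by omega), ?_⟩
    rw [← powWord_add_card]
    congr 1
    omega

section LowerBound

variable (F k t h η)

/-- The exponents of the monomials evaluating into the Schur square of the twisted code. -/
def sqExponents : Set ℕ :=
  {n | powWord F n ∈ schurSq (stdCode F (twistedPolySet F k t h η))}

variable {F k t h η}

theorem add_mem_sqExponents {i j : ℕ} (hi : i < k) (hih : i ≠ h) (hj : j < k) (hjh : j ≠ h) :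
    i + j ∈ sqExponents F k t h η := by
  rw [sqExponents, Set.mem_ofPred_eq, ← powWord_mul]
  exact mul_mem_schurSq (powWord_mem_stdCode hi hih) (powWord_mem_stdCode hj hjh)

theorem mem_sqExponents_iff (hη : η ≠ 0) (hh : h < k) {i : ℕ} (hi : i < k) (hih : i ≠ h) :
    i + h ∈ sqExponents F k t h η ↔ i + (k - 1 + t) ∈ sqExponents F k t h η := by
  have hmem : powWord F (i + h) + η • powWord F (i + (k - 1 + t)) ∈
      schurSq (stdCode F (twistedPolySet F k t h η)) := by
    rw [← powWord_mul, ← powWord_mul, ← mul_smul_comm, ← mul_add]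
    exact mul_mem_schurSq (powWord_mem_stdCode hi hih) (twisted_powWord_mem_stdCode hh)
  simp only [sqExponents, Set.mem_ofPred_eq]
  rw [← Submodule.smul_mem_iff _ hη (x := powWord F (i + (k - 1 + t)))]
  exact ⟨fun H => (Submodule.add_mem_iff_right _ H).1 hmem,
    fun H => (Submodule.add_mem_iff_left _ H).1 hmem⟩

theorem sqExponents_of_zero [Fintype F] (hη : η ≠ 0) (hk : 3 ≤ k) (htk : t ≤ k - 2)
    (h1 : Fintype.card F + 1 < 2 * k + 2 * t) (h2 : 2 * k + t ≤ Fintype.card F + 1)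
    {n : ℕ} (hn : n < 2 * k + t - 1) : n ∈ sqExponents F k t 0 η := by
  have hmid (m : ℕ) (hm : 2 ≤ m) (hm' : m ≤ 2 * k - 2) : m ∈ sqExponents F k t 0 η := by
    by_cases hmk : m ≤ k
    · convert add_mem_sqExponents (F := F) (η := η) (t := t) (i := 1) (j := m - 1) (h := 0)
        (k := k) (by omega) (by omega) (by omega) (by omega) using 1
      omega
    · convert add_mem_sqExponents (F := F) (η := η) (t := t) (i := k - 1) (j := m - (k - 1))
        (h := 0) (k := k) (by omega) (by omega) (by omega) (by omega) using 1
      omega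
  have hpos (m : ℕ) (hm : 1 ≤ m) (hm' : m < 2 * k + t - 1) : m ∈ sqExponents F k t 0 η := by
    by_cases hm1 : m = 1
    · subst hm1
      exact (mem_sqExponents_iff hη (by omega) (i := 1) (by omega) (by omega)).2
        (hmid _ (by omega) (by omega))
    by_cases hm2 : m ≤ 2 * k - 2
    · exact hmid m (by omega) hm2
    · have := (mem_sqExponents_iff (F := F) (t := t) (h := 0) hη (by omega)
        (i := m - (k - 1 + t)) (by omega) (by omega)).1 (hmid _ (by omega) (by omega))
      rwa [Nat.sub_add_cancel (by omega)] at this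
  rcases Nat.eq_zero_or_pos n with rfl | hn0
  · have hg := twisted_powWord_mem_stdCode (F := F) (k := k) (t := t) (h := 0) (η := η) (by omega)
    have hsq := mul_mem_schurSq hg hg
    have hexp : (powWord F 0 + η • powWord F (k - 1 + t)) *
        (powWord F 0 + η • powWord F (k - 1 + t)) = powWord F 0 +
          ((2 * η) • powWord F (k - 1 + t) +
            (η * η) • powWord F (2 * k + 2 * t - 1 - Fintype.card F)) := by
      have hred : powWord F (2 * k + 2 * t - 1 - Fintype.card F) =
          powWord F (k - 1 + t) * powWord F (k - 1 + t) := by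
        rw [powWord_mul, show 2 * k + 2 * t - 1 - Fintype.card F =
          2 * k + 2 * t - 2 - Fintype.card F + 1 by omega, ← powWord_add_card]
        congr 1
        omega
      rw [hred]
      funext x
      simp [powWord]
      ring
    rw [hexp] at hsq
    exact (Submodule.add_mem_iff_left _ (add_mem
      (Submodule.smul_mem _ _ (hpos (k - 1 + t) (by omega) (by omega)))
      (Submodule.smul_mem _ _ (hpos _ (by omega) (by omega))))).1 hsq
  · exact hpos n hn0 hn

theorem sqExponents_of_pos (hη : η ≠ 0) (hk : 4 ≤ k) (ht : 1 ≤ t) (hh : 1 ≤ h)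
    (hth : t + h ≤ k - 1) {n : ℕ} (hn : n < 2 * k + t - 1) : n ∈ sqExponents F k t h η := by
  have hsum (i j m : ℕ) (hm : m = i + j) (hi : i < k) (hih : i ≠ h) (hj : j < k) (hjh : j ≠ h) :
      m ∈ sqExponents F k t h η := hm ▸ add_mem_sqExponents hi hih hj hjh
  have hgen (m : ℕ) (hm : m ≤ 2 * k - 2) (hm1 : h = 1 → m ≠ 1)
      (hm2 : h = k - 2 → m ≠ 2 * k - 3) : m ∈ sqExponents F k t h η := by
    by_cases hmk : m < k
    · by_cases hmh : m = h
      · exact hsum 1 (m - 1) m (by omega) (by omega) (by omega) (by omega) (by omega)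
      · exact hsum 0 m m (by omega) (by omega) (by omega) (by omega) (by omega)
    · by_cases hmh : m - (k - 1) = h
      · exact hsum (k - 2) (h + 1) m (by omega) (by omega) (by omega) (by omega) (by omega)
      · exact hsum (k - 1) (m - (k - 1)) m (by omega) (by omega) (by omega) (by omega) (by omega)
  have hlow (m : ℕ) (hm : m ≤ 2 * k - 2) : m ∈ sqExponents F k t h η := by
    by_cases hm1 : h = 1 ∧ m = 1
    · obtain ⟨rfl, rfl⟩ := hm1
      exact (mem_sqExponents_iff hη (by omega) (i := 0) (by omega) (by omega)).2
        (hgen _ (by omega) (by omega) (by omega))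
    by_cases hm2 : h = k - 2 ∧ m = 2 * k - 3
    · have := (mem_sqExponents_iff (F := F) (t := t) (h := h) hη (by omega) (i := k - 3)
        (by omega) (by omega)).1 (hgen _ (by omega) (by omega) (by omega))
      convert this using 1
      omega
    · exact hgen m hm (by omega) (by omega)
  by_cases hnk : n ≤ 2 * k - 2
  · exact hlow n hnk
  · have := (mem_sqExponents_iff (F := F) (t := t) (h := h) hη (by omega)
      (i := n - (k - 1 + t)) (by omega) (by omega)).1 (hlow _ (by omega))
    rwa [Nat.sub_add_cancel (by omega)] at this

end LowerBound

theorem schurSq_twisted_eq [Fintype F] (hη : η ≠ 0) (hk : 3 ≤ k) (ht : 1 ≤ t)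
    (h1 : Fintype.card F + 1 < 2 * k + 2 * t) (h2 : 2 * k + t ≤ Fintype.card F + 1)
    (hcase : (h = 0 ∧ t ≤ k - 2) ∨ (1 ≤ h ∧ t + h ≤ k - 1)) :
    schurSq (stdCode F (twistedPolySet F k t h η)) =
      Submodule.span F (powWord F '' Set.Iio (2 * k + t - 1)) := by
  refine le_antisymm (schurSq_twisted_le_s8 (by omega) h1 h2) (Submodule.span_le.2 ?_)
  rintro _ ⟨n, hn, rfl⟩
  rw [Set.mem_Iio] at hn
  rcases hcase with ⟨rfl, htk⟩ | ⟨hh, hth⟩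
  · exact sqExponents_of_zero hη hk htk h1 h2 hn
  · by_cases hk3 : k = 3
    · -- here `k = 3`, `t = h = 1`, so that `F` would have six elements
      exfalso
      have hcard : Fintype.card F = 6 := by omega
      have hpp : IsPrimePow 6 := hcard ▸ FiniteField.isPrimePow_card F
      have h23 := Nat.Coprime.isPrimePow_dvd_mul (n := 6) (a := 2) (b := 3) (by norm_num) hpp
      norm_num at h23
    · exact sqExponents_of_pos hη (by omega) ht hh hth hn

end FiniteField

theorem stmt_8 (F : Type) [Field F] [Fintype F] (q k t h : ℕ)
    (hq : Fintype.card F = q) (hk : 3 ≤ k) (ht : 1 ≤ t)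
    (η : F) (hη : η ≠ 0)
    (h1 : q + 1 < 2 * k + 2 * t) (h2 : 2 * k + t ≤ q + 1)
    (hcase : (h = 0 ∧ t ≤ k - 2) ∨ (1 ≤ h ∧ t + h ≤ k - 1)) :
    dualCode ((schurSq (stdCode F (twistedPolySet F k t h η))) : Set (F → F)) =
      stdCode F {f : Polynomial F | f.degree < (q + 1 - (2 * k + t) : ℕ)} := by
  subst hq
  rw [schurSq_twisted_eq hη hk ht h1 h2 hcase, dualCode_span_powWord _ (by omega),
    show Fintype.card F - (2 * k + t - 1) = Fintype.card F + 1 - (2 * k + t) by omega]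
end
end

section
/- Let m > 2 be an integer, q = 2^m, and k, t, h integers with k ≥ 3, t ≥ 1, h ≥ 0, t+h ≤ k−1, (q−2t+1)/2 < k < (q−t+1)/2, and η ∈ 𝔽_q^*. Let n be an integer with 2k+t ≤ n ≤ q, let α = (α_{i_1},…,α_{i_n}) be a vector of n pairwise distinct elements of 𝔽_{2^m}, and define v = (v_1,…,v_n) by v_j = Π_{β ∈ 𝔽_{2^m} \ {α_{i_1},…,α_{i_n}}} (α_{i_j} − β)^{2^{m−1}}. Then each v_j is nonzero and the GTRS code C_{V_{k,t,h,η}}(α,v) is self-orthogonal. -/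
open Polynomial

noncomputable section

/-- The values over a finite field of a polynomial of degree below `q - 1` sum to zero. -/
theorem sum_eval_eq_zero_of_natDegree_lt {F : Type} [Field F] [Fintype F] (p : Polynomial F)
    (hp : p.natDegree < Fintype.card F - 1) : ∑ x, p.eval x = 0 := by
  simp_rw [eval_eq_sum_range]
  rw [Finset.sum_comm]
  refine Finset.sum_eq_zero fun i hi => ?_
  rw [← Finset.mul_sum, FiniteField.sum_pow_lt_card_sub_one F i, mul_zero]
  exact (Nat.le_of_lt_succ (Finset.mem_range.mp hi)).trans_lt hp

theorem pow_eq_pow_sub_card_sub_one {F : Type} [Field F] [Fintype F] (x : F) {e : ℕ}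
    (he : Fintype.card F ≤ e) : x ^ e = x ^ (e - (Fintype.card F - 1)) := by
  have hc := Fintype.card_pos (α := F)
  obtain ⟨d, rfl⟩ := Nat.exists_eq_add_of_le he
  rw [pow_add, FiniteField.pow_card, ← pow_succ',
    show Fintype.card F + d - (Fintype.card F - 1) = d + 1 by omega]

theorem natDegree_sum_range_C_mul_X_pow_le {F : Type} [Field F] (a : ℕ → F) (k : ℕ) :
    (∑ i ∈ Finset.range k, Polynomial.C (a i) * Polynomial.X ^ i).natDegree ≤ k - 1 := by
  refine natDegree_sum_le_of_forall_le _ _ fun i hi => ?_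
  have := Finset.mem_range.mp hi
  exact (natDegree_C_mul_X_pow_le _ _).trans (by omega)

theorem stmt_16 (F : Type) [Field F] [Fintype F] [DecidableEq F] (m k t h n : ℕ)
    (hm : 2 < m) (hq : Fintype.card F = 2 ^ m)
    (hk : 3 ≤ k) (ht : 1 ≤ t) (hth : t + h ≤ k - 1)
    (h1 : 2 ^ m + 1 < 2 * k + 2 * t) (h2 : 2 * k + t < 2 ^ m + 1)
    (η : F) (hη : η ≠ 0)
    (hn1 : 2 * k + t ≤ n) (hn2 : n ≤ 2 ^ m)
    (α : Fin n → F) (hα : Function.Injective α)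
    (v : Fin n → F)
    (hv : ∀ j, v j =
      ∏ β ∈ Finset.univ \ Finset.image α Finset.univ, (α j - β) ^ 2 ^ (m - 1)) :
    (∀ j, v j ≠ 0) ∧ SelfOrthogonal (evalCode (twistedPolySet F k t h η) α v) := by
  set S := Finset.univ \ Finset.image α Finset.univ with hS
  have hnotMem : ∀ j, α j ∉ S := fun j hj => by simp [hS] at hj
  refine ⟨fun j => ?_, ?_⟩
  · rw [hv, Finset.prod_ne_zero_iff]
    intro β hβ
    refine pow_ne_zero _ (sub_ne_zero.mpr ?_)
    rintro rfl
    exact hnotMem j hβ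
  rintro _ ⟨_, ⟨a, rfl⟩, rfl⟩ _ ⟨_, ⟨b, rfl⟩, rfl⟩
  set P : Polynomial F := ∏ β ∈ S, (X - C β) with hP
  have hvP : ∀ j, v j * v j = P.eval (α j) := by
    intro j
    rw [hv, ← Finset.prod_mul_distrib, hP, eval_prod]
    refine Finset.prod_congr rfl fun β _ => ?_
    rw [← pow_two, ← pow_mul, ← pow_succ, Nat.sub_add_cancel (by omega), ← hq,
      FiniteField.pow_card]
    simp
  have hPdeg : P.natDegree = 2 ^ m - n := by
    rw [hP, natDegree_prod_of_monic _ _ fun β _ => monic_X_sub_C β]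
    simp [hS, Finset.card_sdiff, Finset.card_image_of_injective _ hα, hq]
  have hsum : ∀ G : Polynomial F, ∑ j, P.eval (α j) * G.eval (α j) =
      ∑ x, P.eval x * G.eval x := by
    intro G
    rw [← Finset.sum_image (s := Finset.univ) (g := α) (f := fun x => P.eval x * G.eval x)
      hα.injOn]
    refine Finset.sum_subset (Finset.subset_univ _) fun x _ hx => ?_
    have hxS : x ∈ S := by simpa [hS] using hx
    rw [hP, eval_prod, Finset.prod_eq_zero hxS (by simp), zero_mul]
  set f := ∑ i ∈ Finset.range k, C (a i) * X ^ i with hf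
  set g := ∑ i ∈ Finset.range k, C (b i) * X ^ i with hg
  have hfdeg : f.natDegree ≤ k - 1 := natDegree_sum_range_C_mul_X_pow_le a k
  have hgdeg : g.natDegree ≤ k - 1 := natDegree_sum_range_C_mul_X_pow_le b k
  set e := 2 * (k - 1 + t) - (2 ^ m - 1) with he
  set A := C (η * a h) * X ^ (k - 1 + t) with hA
  set B := C (η * b h) * X ^ (k - 1 + t) with hB
  have hAdeg : A.natDegree ≤ k - 1 + t := natDegree_C_mul_X_pow_le _ _
  have hBdeg : B.natDegree ≤ k - 1 + t := natDegree_C_mul_X_pow_le _ _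
  -- Replacing the top monomial of the product by a lower one does not change its values.
  set G := f * g + f * B + A * g + C (η * a h * (η * b h)) * X ^ e with hG
  have hGeval : ∀ x, ((f + A) * (g + B)).eval x = G.eval x := by
    intro x
    have hx : x ^ (k - 1 + t) * x ^ (k - 1 + t) = x ^ e := by
      rw [← pow_add, ← two_mul, pow_eq_pow_sub_card_sub_one x (by omega), hq]
    simp only [hG, hA, hB, eval_add, eval_mul, eval_C, eval_pow, eval_X]
    rw [← hx]
    ring
  have hGdeg : G.natDegree ≤ 2 * k - 2 + t := by
    refine natDegree_add_le_of_degree_le (natDegree_add_le_of_degree_le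
      (natDegree_add_le_of_degree_le ?_ ?_) ?_) ?_
    · exact natDegree_mul_le.trans (by omega)
    · exact natDegree_mul_le.trans (by omega)
    · exact natDegree_mul_le.trans (by omega)
    · exact (natDegree_C_mul_X_pow_le _ _).trans (by omega)
  calc ∑ j, v j * (f + A).eval (α j) * (v j * (g + B).eval (α j))
      = ∑ j, P.eval (α j) * G.eval (α j) := by
        refine Finset.sum_congr rfl fun j _ => ?_
        rw [← hGeval, ← hvP, eval_mul]
        ring
    _ = ∑ x, (P * G).eval x := by simp only [hsum, eval_mul]
    _ = 0 := by
        refine sum_eval_eq_zero_of_natDegree_lt _ (natDegree_mul_le.trans_lt ?_)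
        omega
end
end
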